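/- arXiv:2112.01386 — 5 statements merged into one kernel-verified Lean document; each statement's English description precedes it below -/
import Mathlib

section
/- Let α₁, α₂ ∈ [0, π/2) satisfy cos²(α₁) + cos²(α₂) > 1, and write c₁ = cos(α₁), c₂ = cos(α₂), s₁ = sin(α₁), s₂ = sin(α₂). Then for every y ∈ [−s₁, s₁] one has c₂²·(c₁c₂ + y·s₂)² / ((c₁c₂ + y·s₂)² + s₁² − y²) ≥ c₁² + c₂² − 1; in particular the minimum of the left-hand side over y ∈ [−s₁, s₁] is at least c₁² + c₂² − 1. -/
open Real

theorem stmt_0 (α₁ α₂ : ℝ)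
    (h₁ : α₁ ∈ Set.Ico 0 (π / 2)) (h₂ : α₂ ∈ Set.Ico 0 (π / 2))
    (hgt : Real.cos α₁ ^ 2 + Real.cos α₂ ^ 2 > 1) :
    ∀ y ∈ Set.Icc (-(Real.sin α₁)) (Real.sin α₁),
      Real.cos α₂ ^ 2 * (Real.cos α₁ * Real.cos α₂ + y * Real.sin α₂) ^ 2 /
        ((Real.cos α₁ * Real.cos α₂ + y * Real.sin α₂) ^ 2 + Real.sin α₁ ^ 2 - y ^ 2)
      ≥ Real.cos α₁ ^ 2 + Real.cos α₂ ^ 2 - 1 := by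
  rintro y ⟨hy₁, hy₂⟩
  have hc₁ : 0 < cos α₁ := cos_pos_of_mem_Ioo ⟨by linarith [h₁.1, pi_pos], h₁.2⟩
  have hc₂ : 0 < cos α₂ := cos_pos_of_mem_Ioo ⟨by linarith [h₂.1, pi_pos], h₂.2⟩
  have hs₁ : 0 ≤ sin α₁ := sin_nonneg_of_nonneg_of_le_pi h₁.1 (by linarith [h₁.2, pi_pos])
  have hs₂ : 0 ≤ sin α₂ := sin_nonneg_of_nonneg_of_le_pi h₂.1 (by linarith [h₂.2, pi_pos])
  have e₁ := sin_sq_add_cos_sq α₁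
  have e₂ := sin_sq_add_cos_sq α₂
  generalize cos α₁ = c₁ at *
  generalize cos α₂ = c₂ at *
  generalize sin α₁ = s₁ at *
  generalize sin α₂ = s₂ at *
  have hlt₁ : s₁ < c₂ := lt_of_pow_lt_pow_left₀ 2 hc₂.le (by linarith)
  have hlt₂ : s₂ < c₁ := lt_of_pow_lt_pow_left₀ 2 hc₁.le (by linarith)
  have hA : 0 < c₁ * c₂ + y * s₂ := by
    have h : s₁ * s₂ < c₂ * c₁ := mul_lt_mul'' hlt₁ hlt₂ hs₁ hs₂
    have h' : -s₁ * s₂ ≤ y * s₂ := mul_le_mul_of_nonneg_right hy₁ hs₂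
    linarith
  have hy : y ^ 2 ≤ s₁ ^ 2 := sq_le_sq' hy₁ hy₂
  have hD : 0 < (c₁ * c₂ + y * s₂) ^ 2 + s₁ ^ 2 - y ^ 2 := by
    linarith [pow_pos hA 2]
  rw [ge_iff_le, le_div_iff₀ hD]
  -- The difference of the two sides is a perfect square.
  have key : c₂ ^ 2 * (c₁ * c₂ + y * s₂) ^ 2 -
      (c₁ ^ 2 + c₂ ^ 2 - 1) * ((c₁ * c₂ + y * s₂) ^ 2 + s₁ ^ 2 - y ^ 2) =
      (c₁ * c₂ * y + s₁ ^ 2 * s₂) ^ 2 := by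
    have f₁ : c₁ ^ 2 = 1 - s₁ ^ 2 := by linarith
    have f₂ : c₂ ^ 2 = 1 - s₂ ^ 2 := by linarith
    ring_nf
    simp only [show c₁ ^ 4 = (c₁ ^ 2) ^ 2 by ring, show c₁ ^ 3 = c₁ ^ 2 * c₁ by ring, f₁, f₂]
    ring
  linarith [sq_nonneg (c₁ * c₂ * y + s₁ ^ 2 * s₂)]
end

section
/- Let H be a complex inner product space, let Ω ∈ H be a unit vector, and let P₁, P₂, P₃ be orthogonal projections on H (continuous linear maps that are idempotent and self-adjoint). Set V = (1/3)·(‖P₁Ω‖² + ‖P₂Ω‖² + ‖P₃Ω‖²) and suppose V = 2/3 + ε with ε ≥ 0. Set E = (1/2)·(‖P₃P₂P₁Ω‖² + ‖P₃P₁P₂Ω‖²). Then E ≥ 9ε⁴/2. -/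
open scoped ComplexInnerProductSpace

section Projection

variable {H : Type*} [NormedAddCommGroup H] [InnerProductSpace ℂ H] {P : H →L[ℂ] H}

lemma re_inner_idempotent_selfAdjoint (hidem : P ∘L P = P)
    (hsa : ∀ x y : H, ⟪P x, y⟫ = ⟪x, P y⟫) (x : H) :
    (⟪x, P x⟫).re = ‖P x‖ ^ 2 := by
  have h : P (P x) = P x := DFunLike.congr_fun hidem x
  have h' := hsa x (P x)
  rw [h] at h'
  rw [← h']
  exact (norm_sq_eq_re_inner (𝕜 := ℂ) (P x)).symm

lemma norm_idempotent_selfAdjoint_le (hidem : P ∘L P = P)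
    (hsa : ∀ x y : H, ⟪P x, y⟫ = ⟪x, P y⟫) (x : H) : ‖P x‖ ≤ ‖x‖ := by
  have h := re_inner_idempotent_selfAdjoint hidem hsa x
  have h' : (⟪x, P x⟫).re ≤ ‖x‖ * ‖P x‖ := re_inner_le_norm (𝕜 := ℂ) x (P x)
  by_contra! hlt
  nlinarith [norm_nonneg x]

lemma norm_sub_idempotent_selfAdjoint_sq (hidem : P ∘L P = P)
    (hsa : ∀ x y : H, ⟪P x, y⟫ = ⟪x, P y⟫) (x : H) :
    ‖x - P x‖ ^ 2 = ‖x‖ ^ 2 - ‖P x‖ ^ 2 := by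
  have h := re_inner_idempotent_selfAdjoint hidem hsa x
  have h' : ‖x - P x‖ ^ 2 = ‖x‖ ^ 2 - 2 * (⟪x, P x⟫).re + ‖P x‖ ^ 2 :=
    norm_sub_sq (𝕜 := ℂ) x (P x)
  rw [h', h]
  ring

end Projection

lemma sum_norm_sq_sub_two_le_norm_add {H : Type*} [NormedAddCommGroup H]
    [InnerProductSpace ℂ H] {Ω : H} (hΩ : ‖Ω‖ = 1) {P₁ P₂ P₃ : H →L[ℂ] H}
    (h₁idem : P₁ ∘L P₁ = P₁) (h₁sa : ∀ x y : H, ⟪P₁ x, y⟫ = ⟪x, P₁ y⟫)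
    (h₂idem : P₂ ∘L P₂ = P₂) (h₂sa : ∀ x y : H, ⟪P₂ x, y⟫ = ⟪x, P₂ y⟫)
    (h₃idem : P₃ ∘L P₃ = P₃) (h₃sa : ∀ x y : H, ⟪P₃ x, y⟫ = ⟪x, P₃ y⟫) :
    ‖P₁ Ω‖ ^ 2 + ‖P₂ Ω‖ ^ 2 + ‖P₃ Ω‖ ^ 2 - 2 ≤
      ‖P₃ (P₂ (P₁ Ω))‖ + ‖P₃ (P₁ (P₂ Ω))‖ := by
  set T : H := P₁ Ω + P₂ Ω - Ω with hT
  set w : H := P₂ (P₁ Ω) + P₁ (P₂ Ω) with hw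
  have e₁ : P₁ (P₁ Ω) = P₁ Ω := DFunLike.congr_fun h₁idem Ω
  have e₂ : P₂ (P₂ Ω) = P₂ Ω := DFunLike.congr_fun h₂idem Ω
  have e₃ (x : H) : P₃ (P₃ x) = P₃ x := DFunLike.congr_fun h₃idem x
  have hT₁ : P₁ T = P₁ (P₂ Ω) := by simp [hT, e₁]
  have hT₂ : P₂ T = P₂ (P₁ Ω) := by simp [hT, e₂]
  have hw_le : ‖w‖ ≤ 2 * ‖T‖ := by
    rw [hw, ← hT₁, ← hT₂]
    linarith [norm_add_le (P₂ T) (P₁ T), norm_idempotent_selfAdjoint_le h₁idem h₁sa T,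
      norm_idempotent_selfAdjoint_le h₂idem h₂sa T]
  have hm : (⟪Ω, w⟫).re = ‖T‖ ^ 2 + (‖P₁ Ω‖ ^ 2 + ‖P₂ Ω‖ ^ 2 - 1) := by
    have i₁ := re_inner_idempotent_selfAdjoint h₁idem h₁sa Ω
    have i₂ := re_inner_idempotent_selfAdjoint h₂idem h₂sa Ω
    have hT_sq : ‖T‖ ^ 2 = ‖P₁ Ω + P₂ Ω‖ ^ 2 - 2 * (⟪P₁ Ω + P₂ Ω, Ω⟫).re + ‖Ω‖ ^ 2 :=
      norm_sub_sq (𝕜 := ℂ) (P₁ Ω + P₂ Ω) Ω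
    have hadd : ‖P₁ Ω + P₂ Ω‖ ^ 2 = ‖P₁ Ω‖ ^ 2 + 2 * (⟪P₁ Ω, P₂ Ω⟫).re + ‖P₂ Ω‖ ^ 2 :=
      norm_add_sq (𝕜 := ℂ) (P₁ Ω) (P₂ Ω)
    have hsymm : (⟪P₂ Ω, P₁ Ω⟫).re = (⟪P₁ Ω, P₂ Ω⟫).re :=
      inner_re_symm (𝕜 := ℂ) (P₂ Ω) (P₁ Ω)
    rw [inner_add_left, h₁sa, h₂sa, Complex.add_re, i₁, i₂, hadd, hΩ] at hT_sq
    rw [hw, inner_add_right, ← h₂sa Ω (P₁ Ω), ← h₁sa Ω (P₂ Ω), Complex.add_re]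
    linarith
  have hsplit : (⟪Ω, w⟫).re = (⟪P₃ Ω, P₃ w⟫).re + (⟪Ω - P₃ Ω, w⟫).re := by
    rw [h₃sa, e₃, inner_sub_left, Complex.sub_re, h₃sa]
    ring
  have hc₁ : (⟪P₃ Ω, P₃ w⟫).re ≤ ‖P₃ Ω‖ * ‖P₃ w‖ := re_inner_le_norm (𝕜 := ℂ) _ _
  have hc₂ : (⟪Ω - P₃ Ω, w⟫).re ≤ ‖Ω - P₃ Ω‖ * ‖w‖ := re_inner_le_norm (𝕜 := ℂ) _ _
  have hP₃ : ‖P₃ Ω‖ ≤ 1 := hΩ ▸ norm_idempotent_selfAdjoint_le h₃idem h₃sa Ω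
  have hc₃ : ‖P₃ Ω‖ * ‖P₃ w‖ ≤ ‖P₃ w‖ := mul_le_of_le_one_left (norm_nonneg _) hP₃
  have hc₄ : ‖Ω - P₃ Ω‖ * ‖w‖ ≤ ‖Ω - P₃ Ω‖ * (2 * ‖T‖) := by gcongr
  have hq := norm_sub_idempotent_selfAdjoint_sq h₃idem h₃sa Ω
  rw [hΩ] at hq
  have htri : ‖P₃ w‖ ≤ ‖P₃ (P₂ (P₁ Ω))‖ + ‖P₃ (P₁ (P₂ Ω))‖ := by
    rw [hw, map_add]
    exact norm_add_le _ _
  linarith [sq_nonneg (‖T‖ - ‖Ω - P₃ Ω‖)]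

theorem stmt_2 {H : Type*} [NormedAddCommGroup H] [InnerProductSpace ℂ H]
    (Ω : H) (hΩ : ‖Ω‖ = 1)
    (P₁ P₂ P₃ : H →L[ℂ] H)
    (h₁idem : P₁ ∘L P₁ = P₁) (h₁sa : ∀ x y : H, ⟪P₁ x, y⟫ = ⟪x, P₁ y⟫)
    (h₂idem : P₂ ∘L P₂ = P₂) (h₂sa : ∀ x y : H, ⟪P₂ x, y⟫ = ⟪x, P₂ y⟫)
    (h₃idem : P₃ ∘L P₃ = P₃) (h₃sa : ∀ x y : H, ⟪P₃ x, y⟫ = ⟪x, P₃ y⟫)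
    (ε : ℝ) (hε : 0 ≤ ε)
    (hV : (1 / 3 : ℝ) * (‖P₁ Ω‖ ^ 2 + ‖P₂ Ω‖ ^ 2 + ‖P₃ Ω‖ ^ 2) = 2 / 3 + ε) :
    (1 / 2 : ℝ) * (‖P₃ (P₂ (P₁ Ω))‖ ^ 2 + ‖P₃ (P₁ (P₂ Ω))‖ ^ 2) ≥ 9 * ε ^ 4 / 2 := by
  have key := sum_norm_sq_sub_two_le_norm_add hΩ h₁idem h₁sa h₂idem h₂sa h₃idem h₃sa
  have hsum : 3 * ε ≤ ‖P₃ (P₂ (P₁ Ω))‖ + ‖P₃ (P₁ (P₂ Ω))‖ := by linarith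
  have b₁ := pow_le_one₀ (n := 2) (norm_nonneg _)
    (hΩ ▸ norm_idempotent_selfAdjoint_le h₁idem h₁sa Ω)
  have b₂ := pow_le_one₀ (n := 2) (norm_nonneg _)
    (hΩ ▸ norm_idempotent_selfAdjoint_le h₂idem h₂sa Ω)
  have b₃ := pow_le_one₀ (n := 2) (norm_nonneg _)
    (hΩ ▸ norm_idempotent_selfAdjoint_le h₃idem h₃sa Ω)
  have hε' : ε ≤ 1 / 3 := by linarith
  have hε_sq : ε ^ 2 ≤ 1 / 2 := by nlinarith
  have hε_four : ε ^ 4 ≤ ε ^ 2 / 2 := by nlinarith [sq_nonneg ε]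
  have hsq : (3 * ε) ^ 2 ≤ (‖P₃ (P₂ (P₁ Ω))‖ + ‖P₃ (P₁ (P₂ Ω))‖) ^ 2 := by gcongr
  linarith [sq_nonneg (‖P₃ (P₂ (P₁ Ω))‖ - ‖P₃ (P₁ (P₂ Ω))‖)]
end

section
/- Let H be a finite-dimensional complex inner product space. For i ∈ {1,2,3}, let P_i = Σ_{s=1}^{S_i} P_i^s, where for each fixed i the operators {P_i^s}_{s=1}^{S_i} are orthogonal projections on H with P_i^s ∘ P_i^{s'} = 0 whenever s ≠ s'. Let σ be a density operator on H (a positive semidefinite self-adjoint operator with trace 1). Define V = (1/3)·Σ_{i=1}^{3} tr(P_i σ) and E = (1/2)·( Σ_{s₃=1}^{S₃} Σ_{s₂=1}^{S₂} Σ_{s₁=1}^{S₁} tr(P₃^{s₃} P₂^{s₂} P₁^{s₁} σ P₁^{s₁} P₂^{s₂}) + Σ_{s₃=1}^{S₃} Σ_{s₂=1}^{S₂} Σ_{s₁=1}^{S₁} tr(P₃^{s₃} P₁^{s₁} P₂^{s₂} σ P₂^{s₂} P₁^{s₁}) ). If V ≥ 2/3, then E ≥ 9·(V − 2/3)⁴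 / (2·S₁·S₂). -/
open scoped ComplexInnerProductSpace

section

variable {H : Type*} [NormedAddCommGroup H] [InnerProductSpace ℂ H]

namespace LinearMap.IsSymmetricProjection

variable {P Q R : H →ₗ[ℂ] H}

theorem apply_apply (hP : P.IsSymmetricProjection) (x : H) : P (P x) = P x :=
  LinearMap.congr_fun hP.isIdempotentElem x

theorem inner_self_apply (hP : P.IsSymmetricProjection) (x : H) :
    ⟪x, P x⟫ = ((‖P x‖ ^ 2 : ℝ) : ℂ) := by
  rw [← hP.apply_apply, ← hP.isSymmetric x (P x), hP.apply_apply, inner_self_eq_norm_sq_to_K]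
  simp

theorem norm_sub_apply_sq (hP : P.IsSymmetricProjection) (x : H) :
    ‖x - P x‖ ^ 2 = ‖x‖ ^ 2 - ‖P x‖ ^ 2 := by
  have h := norm_sub_sq (𝕜 := ℂ) x (P x)
  rw [hP.inner_self_apply] at h
  simp only [RCLike.re_to_complex, Complex.ofReal_re] at h
  linarith

theorem norm_apply_le (hP : P.IsSymmetricProjection) (x : H) : ‖P x‖ ≤ ‖x‖ := by
  have h := hP.norm_sub_apply_sq x
  exact le_of_sq_le_sq (by nlinarith [sq_nonneg ‖x - P x‖]) (norm_nonneg x)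

theorem sum {ι : Type*} [Fintype ι] {p : ι → H →ₗ[ℂ] H} (hp : ∀ i, (p i).IsSymmetricProjection)
    (horth : ∀ i j, i ≠ j → p i ∘ₗ p j = 0) : (∑ i, p i).IsSymmetricProjection where
  isIdempotentElem := by
    classical
    rw [IsIdempotentElem, Finset.sum_mul]
    refine Finset.sum_congr rfl fun i _ => ?_
    rw [Finset.mul_sum, Finset.sum_eq_single i]
    · exact (hp i).isIdempotentElem
    · exact fun j _ hj => horth i j hj.symm
    · simp
  isSymmetric x y := by
    simp only [LinearMap.sum_apply, sum_inner, inner_sum]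
    exact Finset.sum_congr rfl fun i _ => (hp i).isSymmetric x y

theorem norm_sum_apply_sq {ι : Type*} [Fintype ι] {p : ι → H →ₗ[ℂ] H}
    (hp : ∀ i, (p i).IsSymmetricProjection) (horth : ∀ i j, i ≠ j → p i ∘ₗ p j = 0) (x : H) :
    ‖(∑ i, p i) x‖ ^ 2 = ∑ i, ‖p i x‖ ^ 2 := by
  have h := (IsSymmetricProjection.sum hp horth).inner_self_apply x
  rw [LinearMap.sum_apply, inner_sum] at h
  simp only [(hp _).inner_self_apply] at h
  rw [LinearMap.sum_apply]
  exact_mod_cast h.symm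

/-- If `x` lies in the ranges of `P`, `Q`, `R` to a total weight above `2`, then the symmetrised
product `P Q + Q P` followed by `R` keeps a corresponding overlap with `x`. -/
theorem sum_norm_sq_sub_le_re_inner (hP : P.IsSymmetricProjection) (hQ : Q.IsSymmetricProjection)
    (hR : R.IsSymmetricProjection) (x : H) :
    ‖P x‖ ^ 2 + ‖Q x‖ ^ 2 + ‖R x‖ ^ 2 - 2 * ‖x‖ ^ 2 ≤ (⟪x, R (P (Q x) + Q (P x))⟫).re := by
  set φ := P (Q x) + Q (P x) with hφ
  set η := P x + Q x - x with hη
  have hφη : φ = P η + Q η := by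
    simp only [hφ, hη, map_add, map_sub, hP.apply_apply, hQ.apply_apply]
    abel
  have hnorm : ‖φ‖ ≤ 2 * ‖η‖ := by
    rw [hφη]
    linarith [norm_add_le (P η) (Q η), hP.norm_apply_le η, hQ.norm_apply_le η]
  have hxφ : (⟪x, φ⟫).re = 2 * (⟪P x, Q x⟫).re := by
    rw [hφ, inner_add_right, ← hP.isSymmetric x, ← hQ.isSymmetric x, Complex.add_re,
      ← inner_conj_symm (Q x), Complex.conj_re]
    ring
  have hηsq : ‖η‖ ^ 2 = ‖x‖ ^ 2 - ‖P x‖ ^ 2 - ‖Q x‖ ^ 2 + 2 * (⟪P x, Q x⟫).re := by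
    have h1 : η = P x - (x - Q x) := by rw [hη]; abel
    have h2 := norm_sub_sq (𝕜 := ℂ) (P x) (x - Q x)
    have h3 : (⟪P x, x⟫).re = ‖P x‖ ^ 2 := by
      rw [hP.isSymmetric, hP.inner_self_apply, Complex.ofReal_re]
    rw [inner_sub_right, RCLike.re_to_complex, Complex.sub_re, h3, hQ.norm_sub_apply_sq] at h2
    rw [h1, h2]
    ring
  have hsplit : (⟪x, R φ⟫).re = (⟪x, φ⟫).re - (⟪x - R x, φ⟫).re := by
    rw [← hR.isSymmetric, inner_sub_left, Complex.sub_re]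
    ring
  have hcs : (⟪x - R x, φ⟫).re ≤ ‖x - R x‖ * ‖φ‖ := re_inner_le_norm (𝕜 := ℂ) _ _
  have hRx := hR.norm_sub_apply_sq x
  nlinarith [sq_nonneg (‖x - R x‖ - ‖φ‖ / 2), norm_nonneg φ, norm_nonneg η]

theorem two_mul_mul_sub_sq_le (hP : P.IsSymmetricProjection) (hQ : Q.IsSymmetricProjection)
    (hR : R.IsSymmetricProjection) {x : H} (hx : ‖x‖ = 1) {c : ℝ} (hc : 0 ≤ c) :
    2 * c * (‖P x‖ ^ 2 + ‖Q x‖ ^ 2 + ‖R x‖ ^ 2 - 2) - c ^ 2 ≤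
      2 * (‖R (Q (P x))‖ ^ 2 + ‖R (P (Q x))‖ ^ 2) := by
  have h1 := sum_norm_sq_sub_le_re_inner hP hQ hR x
  have h2 : (⟪x, R (P (Q x) + Q (P x))⟫).re ≤ ‖x‖ * ‖R (P (Q x) + Q (P x))‖ :=
    re_inner_le_norm (𝕜 := ℂ) _ _
  have h3 := norm_add_le (R (P (Q x))) (R (Q (P x)))
  rw [map_add] at h1 h2
  rw [hx] at h1 h2
  have h4 := mul_le_mul_of_nonneg_left ((h1.trans h2).trans
    (by simpa using h3)) hc
  nlinarith [sq_nonneg (‖R (P (Q x))‖ + ‖R (Q (P x))‖ - c),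
    sq_nonneg (‖R (P (Q x))‖ - ‖R (Q (P x))‖)]

end LinearMap.IsSymmetricProjection

theorem norm_sum_sq_le_card_mul {ι E : Type*} [Fintype ι] [SeminormedAddCommGroup E] (f : ι → E) :
    ‖∑ i, f i‖ ^ 2 ≤ Fintype.card ι * ∑ i, ‖f i‖ ^ 2 :=
  (pow_le_pow_left₀ (norm_nonneg _) (norm_sum_le _ _) 2).trans sq_sum_le_card_mul_sum_sq

theorem norm_sum_comp_sum_apply_sq_le {ι κ ν : Type*} [Fintype ι] [Fintype κ] [Fintype ν]
    {p : ι → H →ₗ[ℂ] H} {q : κ → H →ₗ[ℂ] H} {r : ν → H →ₗ[ℂ] H}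
    (hr : ∀ i, (r i).IsSymmetricProjection) (horth : ∀ i j, i ≠ j → r i ∘ₗ r j = 0) (x : H) :
    ‖(∑ k, r k) ((∑ j, q j) ((∑ i, p i) x))‖ ^ 2 ≤
      (Fintype.card ι * Fintype.card κ) * ∑ k, ∑ j, ∑ i, ‖r k (q j (p i x))‖ ^ 2 := by
  have h1 : (∑ k, r k) ((∑ j, q j) ((∑ i, p i) x)) =
      ∑ a : κ × ι, (∑ k, r k) (q a.1 (p a.2 x)) := by
    rw [Fintype.sum_prod_type, LinearMap.sum_apply _ q, map_sum]
    simp only [LinearMap.sum_apply _ p, map_sum]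
  rw [h1]
  refine (norm_sum_sq_le_card_mul _).trans_eq ?_
  simp only [LinearMap.IsSymmetricProjection.norm_sum_apply_sq hr horth]
  rw [Finset.sum_comm, Fintype.card_prod]
  simp only [Fintype.sum_prod_type]
  push_cast
  ring

/-- The trace against a positive operator of trace one is a convex combination of expectations
in unit vectors. -/
theorem exists_trace_comp_eq_sum_inner [FiniteDimensional ℂ H] {σ : H →ₗ[ℂ] H}
    (hσ : σ.IsPositive) (htr : LinearMap.trace ℂ H σ = 1) :
    ∃ (n : ℕ) (w : Fin n → ℝ) (e : Fin n → H), (∀ k, 0 ≤ w k) ∧ ∑ k, w k = 1 ∧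
      (∀ k, ‖e k‖ = 1) ∧
      ∀ A : H →ₗ[ℂ] H, LinearMap.trace ℂ H (A ∘ₗ σ) = ∑ k, (w k : ℂ) * ⟪e k, A (e k)⟫ := by
  have hs := hσ.isSymmetric
  refine ⟨_, hs.eigenvalues rfl, hs.eigenvectorBasis rfl, hσ.nonneg_eigenvalues rfl, ?_,
    fun k => (hs.eigenvectorBasis rfl).orthonormal.1 k, fun A => ?_⟩
  · have h := hs.trace_eq_sum_eigenvalues rfl
    rw [htr] at h
    simpa using congrArg Complex.re h.symm
  · rw [LinearMap.trace_eq_sum_inner _ (hs.eigenvectorBasis rfl)]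
    refine Finset.sum_congr rfl fun k _ => ?_
    rw [LinearMap.comp_apply, hs.apply_eigenvectorBasis, map_smul, inner_smul_right]
    rfl

theorem trace_sandwich {P Q R σ : H →ₗ[ℂ] H} :
    LinearMap.trace ℂ H (R ∘ₗ Q ∘ₗ P ∘ₗ σ ∘ₗ P ∘ₗ Q) =
      LinearMap.trace ℂ H ((P ∘ₗ Q ∘ₗ R ∘ₗ Q ∘ₗ P) ∘ₗ σ) := by
  have h := LinearMap.trace_mul_comm ℂ (R * Q * P * σ) (P * Q)
  simpa only [mul_assoc, Module.End.mul_eq_comp, LinearMap.comp_assoc] using h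

theorem inner_sandwich {P Q R : H →ₗ[ℂ] H} (hP : P.IsSymmetric) (hQ : Q.IsSymmetric)
    (hR : R.IsSymmetricProjection) (x : H) :
    ⟪x, (P ∘ₗ Q ∘ₗ R ∘ₗ Q ∘ₗ P) x⟫ = ((‖R (Q (P x))‖ ^ 2 : ℝ) : ℂ) := by
  rw [← hR.inner_self_apply]
  simp only [LinearMap.comp_apply]
  rw [← hP, ← hQ]

end



theorem stmt_4 {H : Type*} [NormedAddCommGroup H] [InnerProductSpace ℂ H]
    [FiniteDimensional ℂ H]
    (S₁ S₂ S₃ : ℕ) (hS₁ : 0 < S₁) (hS₂ : 0 < S₂)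
    (P1 : Fin S₁ → H →ₗ[ℂ] H) (P2 : Fin S₂ → H →ₗ[ℂ] H) (P3 : Fin S₃ → H →ₗ[ℂ] H)
    (h1idem : ∀ s, P1 s ∘ₗ P1 s = P1 s)
    (h1sa : ∀ s, ∀ x y : H, ⟪(P1 s) x, y⟫ = ⟪x, (P1 s) y⟫)
    (h1orth : ∀ s s', s ≠ s' → P1 s ∘ₗ P1 s' = 0)
    (h2idem : ∀ s, P2 s ∘ₗ P2 s = P2 s)
    (h2sa : ∀ s, ∀ x y : H, ⟪(P2 s) x, y⟫ = ⟪x, (P2 s) y⟫)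
    (h2orth : ∀ s s', s ≠ s' → P2 s ∘ₗ P2 s' = 0)
    (h3idem : ∀ s, P3 s ∘ₗ P3 s = P3 s)
    (h3sa : ∀ s, ∀ x y : H, ⟪(P3 s) x, y⟫ = ⟪x, (P3 s) y⟫)
    (h3orth : ∀ s s', s ≠ s' → P3 s ∘ₗ P3 s' = 0)
    (σ : H →ₗ[ℂ] H)
    (hσsa : ∀ x y : H, ⟪σ x, y⟫ = ⟪x, σ y⟫)
    (hσpos : ∀ x : H, 0 ≤ (⟪x, σ x⟫).re)
    (hσtr : LinearMap.trace ℂ H σ = 1)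
    (V E : ℝ)
    (hV : (V : ℂ) = (1 / 3) *
      (LinearMap.trace ℂ H ((∑ s, P1 s) ∘ₗ σ) +
       LinearMap.trace ℂ H ((∑ s, P2 s) ∘ₗ σ) +
       LinearMap.trace ℂ H ((∑ s, P3 s) ∘ₗ σ)))
    (hE : (E : ℂ) = (1 / 2) *
      ((∑ s₃, ∑ s₂, ∑ s₁, LinearMap.trace ℂ H
          (P3 s₃ ∘ₗ P2 s₂ ∘ₗ P1 s₁ ∘ₗ σ ∘ₗ P1 s₁ ∘ₗ P2 s₂)) +
       (∑ s₃, ∑ s₂, ∑ s₁, LinearMap.trace ℂ H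
          (P3 s₃ ∘ₗ P1 s₁ ∘ₗ P2 s₂ ∘ₗ σ ∘ₗ P2 s₂ ∘ₗ P1 s₁))))
    (hV23 : V ≥ 2 / 3) :
    E ≥ 9 * (V - 2 / 3) ^ 4 / (2 * S₁ * S₂) := by
  have h1 : ∀ s, (P1 s).IsSymmetricProjection := fun s => ⟨h1idem s, h1sa s⟩
  have h2 : ∀ s, (P2 s).IsSymmetricProjection := fun s => ⟨h2idem s, h2sa s⟩
  have h3 : ∀ s, (P3 s).IsSymmetricProjection := fun s => ⟨h3idem s, h3sa s⟩
  have hT1 := LinearMap.IsSymmetricProjection.sum h1 h1orth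
  have hT2 := LinearMap.IsSymmetricProjection.sum h2 h2orth
  have hT3 := LinearMap.IsSymmetricProjection.sum h3 h3orth
  have hσ : σ.IsPositive := ⟨hσsa, fun x => by rw [hσsa]; exact hσpos x⟩
  obtain ⟨n, w, e, hw, hw1, he, htrace⟩ := exists_trace_comp_eq_sum_inner hσ hσtr
  have hV' : V = ∑ k, w k * ((‖(∑ s, P1 s) (e k)‖ ^ 2 + ‖(∑ s, P2 s) (e k)‖ ^ 2 +
      ‖(∑ s, P3 s) (e k)‖ ^ 2) / 3) := by
    have : (V : ℂ) = ((∑ k, w k * ((‖(∑ s, P1 s) (e k)‖ ^ 2 + ‖(∑ s, P2 s) (e k)‖ ^ 2 +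
      ‖(∑ s, P3 s) (e k)‖ ^ 2) / 3) : ℝ) : ℂ) := by
      rw [hV, htrace, htrace, htrace, ← Finset.sum_add_distrib, ← Finset.sum_add_distrib,
        Finset.mul_sum, Complex.ofReal_sum]
      refine Finset.sum_congr rfl fun k _ => ?_
      rw [hT1.inner_self_apply, hT2.inner_self_apply, hT3.inner_self_apply]
      push_cast
      ring
    exact_mod_cast this
  have hE' : E = ∑ k, w k * (((∑ s₃, ∑ s₂, ∑ s₁, ‖P3 s₃ (P2 s₂ (P1 s₁ (e k)))‖ ^ 2) +
      ∑ s₃, ∑ s₂, ∑ s₁, ‖P3 s₃ (P1 s₁ (P2 s₂ (e k)))‖ ^ 2) / 2) := by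
    have : (E : ℂ) = ((∑ k, w k * (((∑ s₃, ∑ s₂, ∑ s₁, ‖P3 s₃ (P2 s₂ (P1 s₁ (e k)))‖ ^ 2) +
      ∑ s₃, ∑ s₂, ∑ s₁, ‖P3 s₃ (P1 s₁ (P2 s₂ (e k)))‖ ^ 2) / 2) : ℝ) : ℂ) := by
      rw [hE]
      simp only [trace_sandwich, htrace, inner_sandwich (h1 _).isSymmetric (h2 _).isSymmetric (h3 _),
        inner_sandwich (h2 _).isSymmetric (h1 _).isSymmetric (h3 _)]
      simp only [Finset.sum_comm (t := (Finset.univ : Finset (Fin n))), ← Finset.mul_sum]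
      rw [← Finset.sum_add_distrib, Finset.mul_sum, Complex.ofReal_sum]
      refine Finset.sum_congr rfl fun k _ => ?_
      push_cast
      ring
    exact_mod_cast this
  have hS : (0 : ℝ) < S₁ * S₂ := by positivity
  set c := 3 * V - 2 with hc
  have hc0 : 0 ≤ c := by linarith
  have hc1 : c ≤ 1 := by
    have : V ≤ ∑ k, w k * 1 := by
      rw [hV']
      refine Finset.sum_le_sum fun k _ => mul_le_mul_of_nonneg_left ?_ (hw k)
      have b1 := hT1.norm_apply_le (e k)
      have b2 := hT2.norm_apply_le (e k)
      have b3 := hT3.norm_apply_le (e k)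
      rw [he] at b1 b2 b3
      linarith [pow_le_one₀ (n := 2) (norm_nonneg _) b1, pow_le_one₀ (n := 2) (norm_nonneg _) b2,
        pow_le_one₀ (n := 2) (norm_nonneg _) b3]
    rw [← Finset.sum_mul, hw1] at this
    linarith
  have hmain : c ^ 2 ≤ 4 * (S₁ * S₂) * E := by
    have hl : c ^ 2 = ∑ k, w k * (2 * c * (‖(∑ s, P1 s) (e k)‖ ^ 2 + ‖(∑ s, P2 s) (e k)‖ ^ 2 +
        ‖(∑ s, P3 s) (e k)‖ ^ 2 - 2) - c ^ 2) := by
      have : ∑ k, w k * (2 * c * (‖(∑ s, P1 s) (e k)‖ ^ 2 + ‖(∑ s, P2 s) (e k)‖ ^ 2 +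
        ‖(∑ s, P3 s) (e k)‖ ^ 2 - 2) - c ^ 2) = 6 * c * V - (4 * c + c ^ 2) * ∑ k, w k := by
        rw [hV', Finset.mul_sum, Finset.mul_sum, ← Finset.sum_sub_distrib]
        exact Finset.sum_congr rfl fun k _ => by ring
      rw [this, hw1, hc]
      ring
    rw [hl, hE', Finset.mul_sum]
    refine Finset.sum_le_sum fun k _ => ?_
    have b := LinearMap.IsSymmetricProjection.two_mul_mul_sub_sq_le hT1 hT2 hT3 (he k) hc0
    have b1 := norm_sum_comp_sum_apply_sq_le (p := P1) (q := P2) h3 h3orth (e k)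
    have b2 := norm_sum_comp_sum_apply_sq_le (p := P2) (q := P1) h3 h3orth (e k)
    simp only [Fintype.card_fin] at b1 b2
    rw [Finset.sum_congr rfl fun s _ => Finset.sum_comm] at b2
    refine (mul_le_mul_of_nonneg_left (b.trans (mul_le_mul_of_nonneg_left (add_le_add b1 b2)
      zero_le_two)) (hw k)).trans_eq ?_
    ring
  have hc4 : c ^ 4 ≤ c ^ 2 := pow_le_pow_of_le_one hc0 hc1 (by norm_num)
  have hVc : V - 2 / 3 = c / 3 := by rw [hc]; ring
  rw [ge_iff_le, hVc, div_le_iff₀ (by linarith)]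
  nlinarith [sq_nonneg c]
end

section
/- Let H be a complex inner product space, let Ω ∈ H be a unit vector, and let P₁, P₂ be orthogonal projections on H such that ‖P₁Ω‖² + ‖P₂Ω‖² > 1. Then |⟨Ω, P₂P₁Ω⟩|² ≥ (‖P₁Ω‖² + ‖P₂Ω‖² − 1)·‖P₂P₁Ω‖². -/
open scoped ComplexInnerProductSpace

/-- A self-adjoint idempotent map satisfies `⟪P x, P y⟫ = ⟪x, P y⟫`. -/
theorem inner_proj_proj {H : Type*} [NormedAddCommGroup H] [InnerProductSpace ℂ H]
    {P : H →L[ℂ] H} (hidem : P ∘L P = P) (hsa : ∀ x y : H, ⟪P x, y⟫ = ⟪x, P y⟫) (x y : H) :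
    ⟪P x, P y⟫ = ⟪x, P y⟫ := by
  rw [hsa, ← ContinuousLinearMap.comp_apply, hidem]

/-- A self-adjoint idempotent map satisfies `⟪x - P x, y - P y⟫ = ⟪x, y⟫ - ⟪x, P y⟫`. -/
theorem inner_sub_proj_sub_proj {H : Type*} [NormedAddCommGroup H] [InnerProductSpace ℂ H]
    {P : H →L[ℂ] H} (hidem : P ∘L P = P) (hsa : ∀ x y : H, ⟪P x, y⟫ = ⟪x, P y⟫) (x y : H) :
    ⟪x - P x, y - P y⟫ = ⟪x, y⟫ - ⟪x, P y⟫ := by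
  rw [inner_sub_left, inner_sub_right, inner_sub_right, inner_proj_proj hidem hsa, hsa]
  ring

theorem inner_proj_self {H : Type*} [NormedAddCommGroup H] [InnerProductSpace ℂ H]
    {P : H →L[ℂ] H} (hidem : P ∘L P = P) (hsa : ∀ x y : H, ⟪P x, y⟫ = ⟪x, P y⟫) (x : H) :
    ⟪x, P x⟫ = ((‖P x‖ ^ 2 : ℝ) : ℂ) := by
  rw [← inner_proj_proj hidem hsa, inner_self_eq_norm_sq_to_K]
  norm_cast

theorem norm_sub_proj_sq {H : Type*} [NormedAddCommGroup H] [InnerProductSpace ℂ H]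
    {P : H →L[ℂ] H} (hidem : P ∘L P = P) (hsa : ∀ x y : H, ⟪P x, y⟫ = ⟪x, P y⟫) (x : H) :
    ‖x - P x‖ ^ 2 = ‖x‖ ^ 2 - ‖P x‖ ^ 2 := by
  have h := inner_sub_proj_sub_proj hidem hsa x x
  rw [inner_proj_self hidem hsa, inner_self_eq_norm_sq_to_K, inner_self_eq_norm_sq_to_K] at h
  apply Complex.ofReal_injective
  simpa using h

theorem mul_le_normSq_of_normSq_sub_le {a b t : ℝ} {z : ℂ} (ha : 0 ≤ a) (hb : b ≤ 1)
    (hta : t ≤ a) (hab : 1 < a + b) (h : ‖(a : ℂ) - z‖ ^ 2 ≤ (1 - b) * (a - t)) :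
    (a + b - 1) * t ≤ ‖z‖ ^ 2 := by
  simp only [Complex.sq_norm, Complex.normSq_apply, Complex.sub_re, Complex.sub_im,
    Complex.ofReal_re, Complex.ofReal_im] at h ⊢
  rcases hb.eq_or_lt with rfl | hb
  · have hre : a - z.re = 0 := by nlinarith [sq_nonneg (a - z.re), sq_nonneg z.im]
    nlinarith [sq_nonneg z.im]
  · refine le_of_mul_le_mul_left ?_ (sub_pos.2 hb)
    have hs := mul_le_mul_of_nonneg_left h (sub_pos.2 hab).le
    have hsq : 0 ≤ a * ((z.re - (a + b - 1)) ^ 2 + z.im ^ 2) := by positivity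
    linarith

theorem stmt_5 {H : Type*} [NormedAddCommGroup H] [InnerProductSpace ℂ H]
    (Ω : H) (hΩ : ‖Ω‖ = 1)
    (P₁ P₂ : H →L[ℂ] H)
    (h₁idem : P₁ ∘L P₁ = P₁) (h₁sa : ∀ x y : H, ⟪P₁ x, y⟫ = ⟪x, P₁ y⟫)
    (h₂idem : P₂ ∘L P₂ = P₂) (h₂sa : ∀ x y : H, ⟪P₂ x, y⟫ = ⟪x, P₂ y⟫)
    (hgt : ‖P₁ Ω‖ ^ 2 + ‖P₂ Ω‖ ^ 2 > 1) :
    ‖⟪Ω, P₂ (P₁ Ω)⟫‖ ^ 2 ≥ (‖P₁ Ω‖ ^ 2 + ‖P₂ Ω‖ ^ 2 - 1) * ‖P₂ (P₁ Ω)‖ ^ 2 := by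
  have hv := norm_sub_proj_sq h₂idem h₂sa Ω
  have hw := norm_sub_proj_sq h₂idem h₂sa (P₁ Ω)
  rw [hΩ, one_pow] at hv
  refine mul_le_normSq_of_normSq_sub_le (sq_nonneg _) ?_ ?_ hgt ?_
  · exact sub_nonneg.1 (hv ▸ sq_nonneg _)
  · exact sub_nonneg.1 (hw ▸ sq_nonneg _)
  · rw [← inner_proj_self h₁idem h₁sa, ← inner_sub_proj_sub_proj h₂idem h₂sa, ← hv, ← hw,
      ← mul_pow]
    gcongr
    exact norm_inner_le_norm _ _
end

section
/- Let n, m, w be natural numbers, H an m × n matrix over 𝔽₂, s ∈ 𝔽₂^m, s' ∈ 𝔽₂^m, σ a permutation of {1, …, n}, and z₂, z₃ ∈ 𝔽₂^n. Suppose (i) the Hamming weight of z₂ + z₃ equals w, (ii) H · σ⁻¹(z₃) = s + s', and (iii) H · σ⁻¹(z₂) = s'. Then the vector e₀ = σ⁻¹(z₂ + z₃) = σ⁻¹(z₂) + σ⁻¹(z₃) satisfies H · e₀ = s and the Hamming weight of e₀ equals w. (In particular, if the syndrome decoding instance (H, s) with weight parameter w has no solution, then no pair of vectors z₂, z₃ and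 permutation data σ, s' can simultaneously satisfy the three verification checks of Stern's protocol.) -/
theorem hammingNorm_comp_equiv {ι κ α : Type*} [Fintype ι] [Fintype κ] [Zero α] [DecidableEq α]
    (σ : ι ≃ κ) (z : κ → α) : hammingNorm (fun i => z (σ i)) = hammingNorm z := by
  unfold hammingNorm
  exact Finset.card_equiv σ (by simp)

theorem stmt_8 (n m w : ℕ) (H : Matrix (Fin m) (Fin n) (ZMod 2))
    (s s' : Fin m → ZMod 2) (σ : Equiv.Perm (Fin n)) (z₂ z₃ : Fin n → ZMod 2)
    (h1 : hammingNorm (z₂ + z₃) = w)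
    (h2 : H.mulVec (fun i => z₃ (σ i)) = s + s')
    (h3 : H.mulVec (fun i => z₂ (σ i)) = s') :
    H.mulVec (fun i => (z₂ + z₃) (σ i)) = s ∧
      hammingNorm (fun i => (z₂ + z₃) (σ i)) = w := by
  refine ⟨?_, (hammingNorm_comp_equiv σ _).trans h1⟩
  change H.mulVec ((fun i => z₂ (σ i)) + fun i => z₃ (σ i)) = s
  rw [Matrix.mulVec_add, h2, h3, add_left_comm]
  ext j
  simp [CharTwo.add_self_eq_zero]
end
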